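/- For every k ≥ 3, n = 2^k and 0 ≤ m < n, there exists a Hamiltonian path P in the hypercube Q_{n+m} whose flip sequence σ = (σ_1, …, σ_{2^{n+m}−1}) contains at least (2^n − (25/8)·(2^n/n) + 4)·2^m indices i with |σ_{i+1} − σ_i| = 1. -/

import Mathlib

open scoped symmDiff

/-- A Hamiltonian path in the hypercube `Q_n` (vertices: subsets of `[n] = {1,…,n}`,
edges: pairs of subsets whose symmetric difference is a singleton), given as the list
of its `2^n` vertices. -/
def IsHamPath (n : ℕ) (l : List (Finset ℕ)) : Prop :=
  (∀ s ∈ l, s ⊆ Finset.Icc 1 n) ∧ l.Nodup ∧ l.length = 2 ^ n ∧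
    l.Chain' (fun s t => ∃ d, s ∆ t = {d})

/-- The flip sequence of a path: the directions of its consecutive edges
(the direction of an edge is the unique element of the symmetric difference of its
endpoints, here obtained as the sum of the elements of that singleton). -/
def flipSeq (l : List (Finset ℕ)) : List ℕ :=
  (l.zip l.tail).map (fun p => (p.1 ∆ p.2).sum id)

/-- A block of type (a) for a `ρ`-run partition: a nonempty block, all of whose entries
are `≤ ρ`, whose consecutive entries increase by exactly `1` throughout or decrease by
exactly `1` throughout (a single entry `≤ ρ` qualifies). -/
def IsRunBlock (ρ : ℕ) (b : List ℕ) : Prop :=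
  b ≠ [] ∧ (∀ a ∈ b, a ≤ ρ) ∧
    (b.Chain' (fun p q => q = p + 1) ∨ b.Chain' (fun p q => p = q + 1))

/-- A `ρ`-run partition of a sequence `σ`: a decomposition of `σ` into contiguous
blocks, each being either a run (type (a)) or a singleton block whose entry
exceeds `ρ` (type (b)). -/
def IsRunPartition (ρ : ℕ) (σ : List ℕ) (bs : List (List ℕ)) : Prop :=
  bs.flatten = σ ∧ ∀ b ∈ bs, IsRunBlock ρ b ∨ ∃ a, ρ < a ∧ b = [a]

/-- The blocks of type (a) (in a valid `ρ`-run partition these are exactly the blocks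
all of whose entries are `≤ ρ`). -/
def runBlocks (ρ : ℕ) (bs : List (List ℕ)) : List (List ℕ) :=
  bs.filter (fun b => b.all (fun a => decide (a ≤ ρ)))

/-- `ν`: the number of blocks of type (a). -/
def runNu (ρ : ℕ) (bs : List (List ℕ)) : ℕ := (runBlocks ρ bs).length

/-- `λ`: the sum over all blocks of type (a) of (block length − 1). -/
def runLambda (ρ : ℕ) (bs : List (List ℕ)) : ℕ :=
  ((runBlocks ρ bs).map (fun b => b.length - 1)).sum

namespace HypercubeRuns

/-- The symmetric difference of the singletons of the entries of a list of directions. -/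
def total : List ℕ → Finset ℕ
  | [] => ∅
  | a :: l => {a} ∆ total l

/-- The vertices visited when following the directions `l` from `s`, except the last one. -/
def walk : Finset ℕ → List ℕ → List (Finset ℕ)
  | _, [] => []
  | s, a :: l => s :: walk (s ∆ {a}) l

/-- The number of consecutive entries differing by exactly `1`. -/
def smoothCount (l : List ℕ) : ℕ :=
  ((l.zip l.tail).filter (fun p => decide (p.2 = p.1 + 1 ∨ p.1 = p.2 + 1))).length

/-- The parity-check column of direction `i`; direction `n` is not checked. -/
def column (n i : ℕ) : ℕ := if i = n then 0 else i ^^^ (i - 1)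

/-- The syndrome of a vertex; the syndrome of `{1,…,i}` is `i` when `i < n`. -/
def syndrome (n : ℕ) (s : Finset ℕ) : ℕ := s.fold (· ^^^ ·) 0 (column n)

theorem total_append (u v : List ℕ) : total (u ++ v) = total u ∆ total v := by
  induction u with
  | nil => exact (bot_symmDiff _).symm
  | cons a u ih => simp [total, ih, symmDiff_assoc]

theorem walk_append (s : Finset ℕ) (u v : List ℕ) :
    walk s (u ++ v) = walk s u ++ walk (s ∆ total u) v := by
  induction u generalizing s with
  | nil => exact congrArg (walk · v) (symmDiff_bot s).symm
  | cons a u ih => simp [total, walk, ih, symmDiff_assoc]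

theorem length_walk (s : Finset ℕ) (l : List ℕ) : (walk s l).length = l.length := by
  induction l generalizing s with
  | nil => rfl
  | cons a l ih => simp [walk, ih]

theorem walk_symmDiff (s g : Finset ℕ) (l : List ℕ) :
    walk (s ∆ g) l = (walk s l).map (· ∆ g) := by
  induction l generalizing s with
  | nil => rfl
  | cons a l ih =>
    simp only [walk, List.map_cons, ← ih]
    rw [symmDiff_right_comm]

theorem subset_of_mem_walk {N : ℕ} {l : List ℕ} (hl : ∀ a ∈ l, a ∈ Finset.Icc 1 N)
    {s : Finset ℕ} (hs : s ⊆ Finset.Icc 1 N) {t : Finset ℕ} (ht : t ∈ walk s l) :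
    t ⊆ Finset.Icc 1 N := by
  induction l generalizing s with
  | nil => simp [walk] at ht
  | cons a l ih =>
    rcases List.mem_cons.1 ht with rfl | ht
    · exact hs
    · refine ih (fun b hb => hl b (by simp [hb])) ?_ ht
      intro y hy
      rcases Finset.mem_symmDiff.1 hy with ⟨hy, -⟩ | ⟨hy, -⟩
      · exact hs hy
      · rw [Finset.mem_singleton.1 hy]
        exact hl a (by simp)

theorem isChain_walk (s : Finset ℕ) (l : List ℕ) :
    (walk s l).IsChain (fun s t => ∃ d, s ∆ t = {d}) := by
  induction l generalizing s with
  | nil => simp [walk]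
  | cons a l ih =>
    cases l with
    | nil => simp [walk]
    | cons b l =>
      refine List.IsChain.cons_cons ⟨a, ?_⟩ (ih _)
      simp

theorem flipSeq_walk (s : Finset ℕ) (l : List ℕ) : flipSeq (walk s l) = l.dropLast := by
  induction l generalizing s with
  | nil => simp [walk, flipSeq]
  | cons a l ih =>
    cases l with
    | nil => simp [walk, flipSeq]
    | cons b l =>
      have := ih (s ∆ {a})
      simp only [flipSeq, walk, List.tail_cons] at this
      simp only [flipSeq, walk, List.tail_cons, List.zip_cons_cons, List.map_cons, this]
      simp

theorem smoothCount_cons_cons (a b : ℕ) (l : List ℕ) :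
    smoothCount (a :: b :: l) =
      (if b = a + 1 ∨ a = b + 1 then 1 else 0) + smoothCount (b :: l) := by
  simp only [smoothCount, List.tail_cons, List.zip_cons_cons, List.filter_cons]
  split_ifs <;> simp_all; omega

theorem smoothCount_append (u v : List ℕ) :
    smoothCount u + smoothCount v ≤ smoothCount (u ++ v) ∧
      smoothCount (u ++ v) ≤ smoothCount u + smoothCount v + 1 := by
  induction u with
  | nil => simp [smoothCount]
  | cons a u ih =>
    cases u with
    | nil =>
      cases v with
      | nil => simp [smoothCount]
      | cons b v =>
        have h : smoothCount [a] = 0 := rfl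
        simp only [List.cons_append, List.nil_append, smoothCount_cons_cons, h]
        split_ifs <;> omega
    | cons b u =>
      simp only [List.cons_append, smoothCount_cons_cons] at ih ⊢
      split_ifs <;> omega

theorem smoothCount_append_cons (u v : List ℕ) (a : ℕ) :
    smoothCount (u ++ a :: v) = smoothCount (u ++ [a]) + smoothCount (a :: v) := by
  induction u with
  | nil => simp [smoothCount]
  | cons b u ih =>
    cases u with
    | nil => simp [smoothCount_cons_cons]; rfl
    | cons c u =>
      simp only [List.cons_append, smoothCount_cons_cons] at ih ⊢
      omega

theorem smoothCount_range' (a r : ℕ) : smoothCount (List.range' a (r + 1)) = r := by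
  induction r generalizing a with
  | zero => rfl
  | succ r ih =>
    have := ih (a + 1)
    rw [List.range'_succ] at this ⊢
    rw [List.range'_succ, smoothCount_cons_cons, this]
    simp [add_comm]

theorem smoothCount_reverse_range' (r : ℕ) :
    smoothCount (List.range' 1 (r + 1)).reverse = r := by
  induction r with
  | zero => rfl
  | succ r ih =>
    rw [List.range'_1_concat, List.reverse_append] at ih ⊢
    rw [List.range'_1_concat, List.reverse_append]
    simp only [List.reverse_singleton, List.singleton_append] at ih ⊢
    rw [smoothCount_cons_cons, ih, if_pos (by omega), add_comm]

theorem syndrome_symmDiff_singleton (n : ℕ) (s : Finset ℕ) (a : ℕ) :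
    syndrome n (s ∆ {a}) = syndrome n s ^^^ column n a := by
  by_cases h : a ∈ s
  · have h1 : s ∆ {a} = s.erase a := by
      ext y; by_cases hy : y = a <;> simp [Finset.mem_symmDiff, hy, h]
    have h2 : syndrome n s = column n a ^^^ syndrome n (s.erase a) := by
      conv_lhs => rw [← Finset.insert_erase h]
      exact Finset.fold_insert (Finset.notMem_erase a s)
    rw [h1, h2, Nat.xor_comm (column n a), Nat.xor_assoc, Nat.xor_self, Nat.xor_zero]
  · have h1 : s ∆ {a} = insert a s := by
      ext y; by_cases hy : y = a <;> simp [Finset.mem_symmDiff, hy, h]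
    rw [h1, Nat.xor_comm]
    exact Finset.fold_insert h

theorem syndrome_symmDiff_pair {n d x : ℕ} (h : column n d = column n x) (s : Finset ℕ) :
    syndrome n (s ∆ ({d} ∆ {x})) = syndrome n s := by
  rw [← symmDiff_assoc, syndrome_symmDiff_singleton, syndrome_symmDiff_singleton, h,
    Nat.xor_assoc, Nat.xor_self, Nat.xor_zero]

theorem Icc_symmDiff_succ (i : ℕ) : Finset.Icc 1 i ∆ {i + 1} = Finset.Icc 1 (i + 1) := by
  ext y
  simp only [Finset.mem_symmDiff, Finset.mem_Icc, Finset.mem_singleton]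
  omega

theorem syndrome_Icc {n i : ℕ} (h : i < n) : syndrome n (Finset.Icc 1 i) = i := by
  induction i with
  | zero => rfl
  | succ i ih =>
    rw [← Icc_symmDiff_succ, syndrome_symmDiff_singleton, ih (by omega), column,
      if_neg (by omega), Nat.add_sub_cancel, Nat.xor_comm (i + 1), ← Nat.xor_assoc,
      Nat.xor_self, Nat.zero_xor]

theorem syndrome_insert {n i : ℕ} (h : i < n) :
    syndrome n (Finset.Icc 1 i ∆ {n}) = i := by
  rw [syndrome_symmDiff_singleton, syndrome_Icc h, column, if_pos rfl, Nat.xor_zero]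

theorem xor_pred_two_pow_mul_odd (a : ℕ) {b : ℕ} (hb : Odd b) :
    (2 ^ a * b) ^^^ (2 ^ a * b - 1) = 2 ^ (a + 1) - 1 := by
  induction a with
  | zero =>
    obtain ⟨c, rfl⟩ := hb
    have h1 := Nat.xor_div_two (a := 2 * c + 1) (b := 2 * c)
    have h2 := Nat.xor_mod_two_eq (m := 2 * c + 1) (n := 2 * c)
    have h3 : (2 * c + 1) / 2 = c := by omega
    have h4 : (2 * c) / 2 = c := by omega
    rw [h3, h4, Nat.xor_self] at h1
    simp only [pow_zero, one_mul, Nat.add_sub_cancel]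
    omega
  | succ a ih =>
    have hy : 0 < 2 ^ a * b := Nat.mul_pos (by positivity) hb.pos
    have he : 2 ^ (a + 1) * b = 2 * (2 ^ a * b) := by ring
    rw [he]
    generalize 2 ^ a * b = y at *
    have h1 := Nat.xor_div_two (a := 2 * y) (b := 2 * y - 1)
    have h2 := Nat.xor_mod_two_eq (m := 2 * y) (n := 2 * y - 1)
    have h3 : (2 * y) / 2 = y := by omega
    have h4 : (2 * y - 1) / 2 = y - 1 := by omega
    rw [h3, h4, ih] at h1
    have : 0 < 2 ^ (a + 1) := by positivity
    rw [pow_succ 2 (a + 1)]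
    omega

theorem walk_range' (a r : ℕ) :
    walk (Finset.Icc 1 a) (List.range' (a + 1) r) =
      (List.range' a r).map (fun i => Finset.Icc 1 i) := by
  induction r generalizing a with
  | zero => rfl
  | succ r ih => simp [List.range'_succ, walk, Icc_symmDiff_succ, ih]

theorem walk_reverse_range' (n r : ℕ) :
    walk (Finset.Icc 1 r ∆ {n}) ((List.range' 1 r).reverse ++ [n]) =
      (List.range (r + 1)).reverse.map (fun i => Finset.Icc 1 i ∆ {n}) := by
  induction r with
  | zero => simp [walk]
  | succ r ih =>
    have h : Finset.Icc 1 (r + 1) ∆ {n} ∆ {r + 1} = Finset.Icc 1 r ∆ {n} := by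
      rw [← Icc_symmDiff_succ, symmDiff_right_comm, symmDiff_symmDiff_cancel_right]
    rw [List.range'_1_concat, List.range_succ]
    simp only [List.reverse_append, List.reverse_singleton, List.nil_append,
      List.cons_append, walk, List.map_cons, add_comm 1 r, h, ih]

theorem total_reverse (l : List ℕ) : total l.reverse = total l := by
  induction l with
  | nil => rfl
  | cons a l ih => simp [total, total_append, ih, symmDiff_comm]

theorem total_range' (r : ℕ) : total (List.range' 1 r) = Finset.Icc 1 r := by
  induction r with
  | zero => rfl
  | succ r ih =>
    rw [List.range'_1_concat, total_append, ih, ← Icc_symmDiff_succ]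
    simp [total, add_comm]

/-- Replacing a direction `d` of a closed walk by `x` and traversing the result twice visits
the original vertices and their translates by `{d} ∆ {x}`. -/
theorem walk_double_perm {u v : List ℕ} {d : ℕ} (x : ℕ) (h : total (u ++ d :: v) = ∅) :
    (walk ∅ ((u ++ x :: v) ++ (u ++ x :: v))).Perm
      (walk ∅ (u ++ d :: v) ++ (walk ∅ (u ++ d :: v)).map (· ∆ ({d} ∆ {x}))) := by
  have hd : total u ∆ total v = {d} := by
    rw [total_append, total, symmDiff_left_comm] at h
    exact (symmDiff_eq_bot.1 h).symm
  have ht : total (u ++ x :: v) = {d} ∆ {x} := by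
    rw [total_append, total, symmDiff_left_comm, hd, symmDiff_comm]
  have e1 : total u ∆ {x} = (total u ∆ {d}) ∆ ({d} ∆ {x}) := by
    rw [symmDiff_assoc, symmDiff_symmDiff_cancel_left]
  have e2 : total u ∆ ({d} ∆ {x}) ∆ {x} = total u ∆ {d} := by
    rw [← symmDiff_assoc, symmDiff_symmDiff_cancel_right]
  have e3 : walk ({d} ∆ {x}) u = (walk ∅ u).map (· ∆ ({d} ∆ {x})) := by
    rw [← walk_symmDiff]; congr 1; exact (bot_symmDiff _).symm
  have e0 : (∅ : Finset ℕ) ∆ total u = total u := bot_symmDiff _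
  have e4 : (∅ : Finset ℕ) ∆ total (u ++ x :: v) = {d} ∆ {x} := by
    rw [ht]; exact bot_symmDiff _
  rw [walk_append ∅ (u ++ x :: v), e4]
  simp only [walk_append, walk, e0, e3, List.map_append, List.map_cons]
  rw [symmDiff_comm ({d} ∆ {x}) (total u), e2, e1, walk_symmDiff (total u ∆ {d})]
  rw [← Multiset.coe_eq_coe]
  simp only [← Multiset.coe_add, ← Multiset.cons_coe, ← Multiset.singleton_add]
  abel

theorem exists_two_pow_column_eq {k n x : ℕ} (hn : n = 2 ^ k) (hx0 : 0 < x) (hx : x < 2 * n)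
    (hxD : x ∉ (Finset.range (k + 1)).image (2 ^ ·)) :
    ∃ j < k, column n (2 ^ j) = column n x := by
  obtain ⟨a, b, hb, rfl⟩ := Nat.exists_eq_two_pow_mul_odd hx0.ne'
  have hab : ∀ i, i < k + 1 → 2 ^ i ≠ 2 ^ a * b := fun i hi h =>
    hxD (Finset.mem_image.2 ⟨i, Finset.mem_range.2 hi, h⟩)
  have ha : 2 ^ a < 2 ^ (k + 1) := by
    rw [pow_succ]
    have := Nat.le_mul_of_pos_right (2 ^ a) hb.pos
    omega
  have ha' := (Nat.pow_lt_pow_iff_right (by norm_num)).1 ha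
  have hb1 : b ≠ 1 := fun h => hab a ha' (by simp [h])
  have hb3 : 3 ≤ b := by obtain ⟨c, rfl⟩ := hb; omega
  have hak : 2 ^ a < 2 ^ k := by
    have := Nat.mul_le_mul_left (2 ^ a) hb3
    have := Nat.pos_of_ne_zero (pow_ne_zero a (two_ne_zero (α := ℕ)))
    omega
  have hak' := (Nat.pow_lt_pow_iff_right (by norm_num)).1 hak
  refine ⟨a, hak', ?_⟩
  have h1 := xor_pred_two_pow_mul_odd a odd_one
  rw [mul_one] at h1
  rw [column, column, if_neg (by omega), if_neg (fun h => hab k (by omega) (by omega)),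
    xor_pred_two_pow_mul_odd a hb, h1]

/-- A closed walk with pairwise distinct vertices, covering the translates of the initial block
by the pairs `{d, x}` with `x ∈ X`. -/
structure IsCycleFor (k n N : ℕ) (X : Finset ℕ) (C : List ℕ) : Prop where
  length_eq : C.length = 2 * n * 2 ^ X.card
  mem_Icc : ∀ a ∈ C, a ∈ Finset.Icc 1 N
  two_le_count : ∀ j < k, 2 ≤ C.count (2 ^ j)
  total_eq : total C = ∅
  nodup : (walk ∅ C).Nodup
  mem_iff : ∀ s ∈ walk ∅ C, ∀ y, y ∉ X → y ∉ (Finset.range (k + 1)).image (2 ^ ·) → 0 < y →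
    (y ∈ s ↔ y ≤ syndrome n s)
  smooth : 2 * n * 2 ^ X.card + 4 ≤ smoothCount C + 6 * 2 ^ X.card

theorem isCycleFor_empty {k n N : ℕ} (hk : 1 ≤ k) (hn : n = 2 ^ k) (hN : n ≤ N) :
    IsCycleFor k n N ∅
      (List.range' 1 (n - 1) ++ n :: ((List.range' 1 (n - 1)).reverse ++ [n])) := by
  have hn2 : 2 ≤ n := by
    rw [hn]; calc 2 = 2 ^ 1 := rfl
      _ ≤ 2 ^ k := Nat.pow_le_pow_right (by norm_num) hk
  have hnD : n ∈ (Finset.range (k + 1)).image (2 ^ ·) :=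
    Finset.mem_image.2 ⟨k, by simp, hn.symm⟩
  obtain ⟨r, rfl⟩ : ∃ r, n = r + 2 := ⟨n - 2, by omega⟩
  have hr : r + 2 - 1 = r + 1 := by omega
  rw [hr]
  have hwalk : walk ∅ (List.range' 1 (r + 1) ++
      (r + 2) :: ((List.range' 1 (r + 1)).reverse ++ [r + 2])) =
      (List.range (r + 2)).map (fun i => Finset.Icc 1 i) ++
        (List.range (r + 2)).reverse.map (fun i => Finset.Icc 1 i ∆ {r + 2}) := by
    have h1 := walk_range' 0 (r + 1)
    have e0 : (∅ : Finset ℕ) ∆ Finset.Icc 1 (r + 1) = Finset.Icc 1 (r + 1) := bot_symmDiff _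
    simp only [Finset.Icc_eq_empty_of_lt zero_lt_one, zero_add] at h1
    rw [walk_append, h1, total_range', walk, e0, walk_reverse_range', List.range_succ (n := r + 1),
      List.range_eq_range']
    simp
  have hmem : ∀ i y, i < r + 2 → y ≠ r + 2 →
      (y ∈ Finset.Icc 1 i ∆ {r + 2} ↔ y ∈ Finset.Icc 1 i) := by
    intro i y _ hy
    simp [Finset.mem_symmDiff, hy]
  constructor
  · simp; omega
  · intro a ha
    simp only [List.mem_append, List.mem_cons, List.mem_reverse, List.mem_range'_1,
      List.not_mem_nil, or_false] at ha
    rw [Finset.mem_Icc]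
    omega
  · intro j hj
    have h1 : 2 ^ j ∈ List.range' 1 (r + 1) := by
      have : 2 ^ j < 2 ^ k := Nat.pow_lt_pow_right (by norm_num) hj
      have : 0 < 2 ^ j := by positivity
      rw [List.mem_range'_1]
      omega
    have h2 := List.count_pos_iff.2 h1
    simp only [List.count_append, List.count_cons, List.count_reverse]
    omega
  · have e : ∀ a : Finset ℕ, a ∆ ∅ = a := symmDiff_bot
    simp only [total_append, total, total_reverse, e]
    rw [symmDiff_left_comm, symmDiff_symmDiff_cancel_left]
    exact symmDiff_self _
  · rw [hwalk]
    have inj : Function.Injective (fun i => Finset.Icc 1 i) := fun i j h => by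
      simpa using congrArg Finset.card h
    refine List.Nodup.append (List.nodup_range.map inj)
      ((List.nodup_reverse.2 List.nodup_range).map
        ((symmDiff_left_injective _).comp inj)) ?_
    intro s hs ht
    simp only [List.mem_map, List.mem_range, List.mem_reverse] at hs ht
    obtain ⟨i, hi, rfl⟩ := hs
    obtain ⟨j, hj, h⟩ := ht
    have h1 : r + 2 ∈ Finset.Icc 1 j ∆ {r + 2} := by
      simp [Finset.mem_symmDiff]; omega
    rw [h, Finset.mem_Icc] at h1
    omega
  · intro s hs y _ hy hy0
    have hyn : y ≠ r + 2 := fun h => hy (h ▸ hnD)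
    rw [hwalk] at hs
    simp only [List.mem_append, List.mem_map, List.mem_range, List.mem_reverse] at hs
    rcases hs with ⟨i, hi, rfl⟩ | ⟨i, hi, rfl⟩
    · rw [syndrome_Icc hi, Finset.mem_Icc]; omega
    · rw [syndrome_insert hi, hmem i y hi hyn, Finset.mem_Icc]; omega
  · rw [smoothCount_append_cons]
    have h1 := smoothCount_range' 1 (r + 1)
    have h2 := smoothCount_reverse_range' (r + 1)
    rw [List.range'_1_concat] at h1 h2
    rw [List.reverse_append, List.reverse_singleton, List.singleton_append] at h2
    have h3 := (smoothCount_append ((r + 2) :: (List.range' 1 (r + 1)).reverse) [r + 2]).1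
    have e : 1 + (r + 1) = r + 2 := by omega
    rw [e] at h1 h2
    rw [List.cons_append] at h3
    simp only [Finset.card_empty, pow_zero]
    omega

theorem IsCycleFor.exists_insert {k n N x : ℕ} {X : Finset ℕ} {C : List ℕ} (hC : IsCycleFor k n N X C)
    (hn : n = 2 ^ k) (hxN : x ∈ Finset.Icc 1 N) (hx : x < 2 * n)
    (hxD : x ∉ (Finset.range (k + 1)).image (2 ^ ·)) (hxX : x ∉ X) :
    ∃ C', IsCycleFor k n N (insert x X) C' := by
  have hx0 : 0 < x := (Finset.mem_Icc.1 hxN).1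
  obtain ⟨j, hj, hcol⟩ := exists_two_pow_column_eq hn hx0 hx hxD
  have hjD : 2 ^ j ∈ (Finset.range (k + 1)).image (2 ^ ·) :=
    Finset.mem_image.2 ⟨j, Finset.mem_range.2 (by omega), rfl⟩
  have hjC : 2 ^ j ∈ C := List.count_pos_iff.1 (by have := hC.two_le_count j hj; omega)
  have hpair : ∀ y, y ∉ (Finset.range (k + 1)).image (2 ^ ·) → y ≠ 2 ^ j :=
    fun y hy h => hy (h ▸ hjD)
  have htr : ∀ (s : Finset ℕ) y, y ∉ (Finset.range (k + 1)).image (2 ^ ·) → y ≠ x →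
      (y ∈ s ∆ ({2 ^ j} ∆ {x}) ↔ y ∈ s) := by
    intro s y hy hyx
    simp [Finset.mem_symmDiff, hpair y hy, hyx]
  have htrx : ∀ s : Finset ℕ, x ∈ s ∆ ({2 ^ j} ∆ {x}) ↔ x ∉ s := by
    intro s
    simp [Finset.mem_symmDiff, hpair x hxD]
  generalize 2 ^ j = d at *
  obtain ⟨u, v, rfl⟩ := List.append_of_mem hjC
  have hperm := walk_double_perm x hC.total_eq
  have hcard : (insert x X).card = X.card + 1 := Finset.card_insert_of_notMem hxX
  refine ⟨(u ++ x :: v) ++ (u ++ x :: v), ?_⟩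
  constructor
  · have := hC.length_eq
    rw [hcard, pow_succ, ← mul_assoc, ← this]
    simp; omega
  · intro a ha
    by_cases hax : a = x
    · exact hax ▸ hxN
    · refine hC.mem_Icc a ?_
      simp only [List.mem_append, List.mem_cons, hax, false_or] at ha ⊢
      tauto
  · intro i hi
    have h := hC.two_le_count i hi
    simp only [List.count_append, List.count_cons] at h ⊢
    split_ifs at h ⊢ <;> omega
  · rw [total_append]; exact symmDiff_self _
  · rw [hperm.nodup_iff]
    refine List.Nodup.append hC.nodup (hC.nodup.map (symmDiff_left_injective _)) ?_
    intro s hs hs'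
    obtain ⟨t, ht, rfl⟩ := List.mem_map.1 hs'
    have h1 := hC.mem_iff _ hs x hxX hxD hx0
    rw [htrx, syndrome_symmDiff_pair hcol] at h1
    have h2 := hC.mem_iff _ ht x hxX hxD hx0
    tauto
  · intro s hs y hy hyD hy0
    rw [Finset.mem_insert, not_or] at hy
    rcases List.mem_append.1 (hperm.mem_iff.1 hs) with hs | hs
    · exact hC.mem_iff s hs y hy.2 hyD hy0
    · obtain ⟨t, ht, rfl⟩ := List.mem_map.1 hs
      rw [htr t y hyD hy.1, syndrome_symmDiff_pair hcol]
      exact hC.mem_iff t ht y hy.2 hyD hy0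
  · have h := hC.smooth
    have h1 := (smoothCount_append u (d :: v)).2
    have h2 := (smoothCount_append [d] v).2
    have h3 := (smoothCount_append u (x :: v)).1
    have h4 := (smoothCount_append [x] v).1
    have h5 := (smoothCount_append (u ++ x :: v) (u ++ x :: v)).1
    have h6 : smoothCount [d] = 0 := rfl
    rw [List.singleton_append] at h2 h4
    rw [hcard, pow_succ, ← mul_assoc, ← mul_assoc]
    omega

theorem exists_isCycleFor {k n N : ℕ} (hk : 1 ≤ k) (hn : n = 2 ^ k) (hN : n ≤ N)
    (hN2 : N < 2 * n) (X : Finset ℕ)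
    (hX : X ⊆ Finset.Icc 1 N \ (Finset.range (k + 1)).image (2 ^ ·)) :
    ∃ C, IsCycleFor k n N X C := by
  induction X using Finset.induction_on with
  | empty => exact ⟨_, isCycleFor_empty hk hn hN⟩
  | insert x X hxX ih =>
    obtain ⟨hx, hX⟩ := Finset.insert_subset_iff.1 hX
    obtain ⟨C, hC⟩ := ih hX
    obtain ⟨hxN, hxD⟩ := Finset.mem_sdiff.1 hx
    exact hC.exists_insert hn hxN (by have := (Finset.mem_Icc.1 hxN).2; omega) hxD hxX

theorem card_Icc_sdiff_two_pow {k n N : ℕ} (hn : n = 2 ^ k) (hN : n ≤ N) :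
    (Finset.Icc 1 N \ (Finset.range (k + 1)).image (2 ^ ·)).card + (k + 1) = N := by
  have hsub : (Finset.range (k + 1)).image (2 ^ ·) ⊆ Finset.Icc 1 N := by
    intro y hy
    obtain ⟨i, hi, rfl⟩ := Finset.mem_image.1 hy
    have hi' := Finset.mem_range.1 hi
    have : 2 ^ i ≤ 2 ^ k := Nat.pow_le_pow_right (by norm_num) (by omega)
    have : 0 < 2 ^ i := by positivity
    simp only [Finset.mem_Icc]
    omega
  have hc : ((Finset.range (k + 1)).image (2 ^ ·)).card = k + 1 := by
    rw [Finset.card_image_of_injective _ (Nat.pow_right_injective le_rfl), Finset.card_range]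
  have := Finset.card_sdiff_add_card_eq_card hsub
  rw [hc, Nat.card_Icc, Nat.add_sub_cancel] at this
  exact this

theorem thirty_two_mul_le_two_pow {n : ℕ} (h : 8 ≤ n) : 32 * n ≤ 2 ^ n := by
  induction n, h using Nat.le_induction with
  | base => norm_num
  | succ n h ih => rw [pow_succ]; omega

end HypercubeRuns

open HypercubeRuns

/-- For `k ≥ 3`, `n = 2^k` and `0 ≤ m < n`, there is a Hamiltonian path in `Q_{n+m}`
whose flip sequence `σ` has at least `(2^n − (25/8)·(2^n/n) + 4)·2^m` indices `i` with
`|σ_{i+1} − σ_i| = 1` (the inequality is stated multiplied through by `8n`). -/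
theorem stmt_14 (k : ℕ) (hk : 3 ≤ k) (n : ℕ) (hn : n = 2 ^ k) (m : ℕ) (hm : m < n) :
    ∃ l : List (Finset ℕ), IsHamPath (n + m) l ∧
      8 * n * (((flipSeq l).zip (flipSeq l).tail).filter
          (fun p => decide (p.2 = p.1 + 1 ∨ p.1 = p.2 + 1))).length
        ≥ (8 * n * 2 ^ n - 25 * 2 ^ n + 32 * n) * 2 ^ m := by
  have h8 : 8 ≤ n := by
    rw [hn]
    exact (Nat.pow_le_pow_right (n := 2) (by norm_num) hk : 2 ^ 3 ≤ 2 ^ k)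
  obtain ⟨C, hC⟩ := exists_isCycleFor (N := n + m) (by omega) hn (by omega) (by omega) _
    (Finset.Subset.refl _)
  have hcard := card_Icc_sdiff_two_pow (N := n + m) hn (by omega)
  have hlen := hC.length_eq
  have hsm := hC.smooth
  generalize (Finset.Icc 1 (n + m) \ (Finset.range (k + 1)).image (2 ^ ·)).card = c at *
  have hM : 2 * n * 2 ^ c = 2 ^ n * 2 ^ m := by
    rw [← pow_add, ← hcard, hn]; ring
  refine ⟨walk ∅ C, ⟨fun s hs => subset_of_mem_walk hC.mem_Icc (Finset.empty_subset _) hs,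
    hC.nodup, by rw [length_walk, hlen, hM, pow_add], isChain_walk ∅ C⟩, ?_⟩
  rw [flipSeq_walk]
  change 8 * n * smoothCount C.dropLast ≥ _
  have hC0 : C ≠ [] := by
    rintro rfl
    have : 0 < 2 * n * 2 ^ c := by positivity
    rw [← hlen] at this
    simp at this
  have hdrop := (smoothCount_append C.dropLast [C.getLast hC0]).2
  rw [List.dropLast_append_getLast hC0] at hdrop
  have hs : smoothCount [C.getLast hC0] = 0 := rfl
  have hG : 2 ^ n * 2 ^ m + 3 ≤ smoothCount C.dropLast + 6 * 2 ^ c := by omega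
  have h32 := Nat.mul_le_mul_right (2 ^ m) (thirty_two_mul_le_two_pow h8)
  have hsub : 25 * 2 ^ n ≤ 8 * n * 2 ^ n := Nat.mul_le_mul_right _ (by omega)
  obtain ⟨e, he⟩ := Nat.exists_eq_add_of_le hsub
  rw [he, Nat.add_sub_cancel_left]
  have he' := congrArg (· * 2 ^ m) he
  have hG' := Nat.mul_le_mul_left (8 * n) hG
  simp only [add_mul] at he'
  nlinarith
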